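/- Extended dualized Kerdock codes: for every odd integer k ≥ 3 there exists a ℤ₄-submodule C of ℤ₄ⁿ with n = 2^{2k} − 2^k + 2^{(k−3)/2}, such that C has exactly 4^{k+1} elements and the minimum Lee weight of a nonzero codeword of C equals 2^{2k} − 2^k. -/

import Mathlib

/-- The Lee weight on `ZMod 4`: `w(0) = 0`, `w(1) = 1`, `w(2) = 2`, `w(3) = 1`. -/
def leeWt (a : ZMod 4) : ℕ := min a.val (4 - a.val)

/-- The Lee weight of a vector in `ZMod 4`ⁿ. -/
def leeWeight {n : ℕ} (x : Fin n → ZMod 4) : ℕ := ∑ i, leeWt (x i)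


/-- lift of a bit to `ZMod 4` -/
def bitLift (a : ZMod 2) : ZMod 4 := (a.val : ZMod 4)

/-- the embedding `ZMod 2 → ZMod 4`, `a ↦ 2 a` -/
def iotaHom : ZMod 2 →+ ZMod 4 where
  toFun a := 2 * bitLift a
  map_zero' := by decide
  map_add' := by decide

lemma bitLift_add : ∀ a b, bitLift (a + b) = bitLift a + bitLift b + 2 * (bitLift a * bitLift b) := by
  decide

lemma bitLift_mul : ∀ a b, bitLift (a * b) = bitLift a * bitLift b := by
  decide

lemma four_eq : (4 : ZMod 4) = 0 := by decide

lemma iota_smul : ∀ (b : ZMod 4) (c : ZMod 2), b * iotaHom c = iotaHom ((b.val : ZMod 2) * c) := by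
  decide

lemma iota_inj : ∀ a b, iotaHom a = iotaHom b → a = b := by decide

lemma iota_neg : ∀ a, - iotaHom a = iotaHom a := by decide

lemma two_mul_val : ∀ b : ZMod 4, ((b.val : ZMod 2)) = 0 → 2 * b = 0 := by decide

/-- A symmetric bilinear form over `ZMod 2` has a `ZMod 4`-valued quadratic refinement. -/
lemma exists_quad {F ι : Type*} [AddCommGroup F] [Module (ZMod 2) F] [Fintype ι]
    (e : Module.Basis ι (ZMod 2) F) (B : F →ₗ[ZMod 2] F →ₗ[ZMod 2] ZMod 2)
    (hB : ∀ x y, B x y = B y x) :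
    ∃ Q : F → ZMod 4, ∀ x y, Q (x + y) = Q x + Q y + iotaHom (B x y) := by
  classical
  let X : F → ι → ZMod 4 := fun x i => bitLift (e.repr x i)
  let M : ι → ι → ZMod 4 := fun i j => bitLift (B (e i) (e j))
  have hM : ∀ i j, M i j = M j i := fun i j => by simp only [M]; rw [hB]
  refine ⟨fun x => ∑ i, ∑ j, X x i * X x j * M i j, fun x y => ?_⟩
  have hX : ∀ i, X (x + y) i = X x i + X y i + 2 * (X x i * X y i) := fun i => by
    simp only [X, map_add, Finsupp.add_apply, bitLift_add]
  have hBxy : B x y = ∑ i, ∑ j, e.repr x i * e.repr y j * B (e i) (e j) := by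
    conv_lhs => rw [← e.sum_repr x, ← e.sum_repr y]
    simp only [map_sum, map_smul, LinearMap.sum_apply, LinearMap.smul_apply, smul_eq_mul,
      Finset.mul_sum]
    rw [Finset.sum_comm]
    refine Finset.sum_congr rfl fun i _ => Finset.sum_congr rfl fun j _ => by ring
  have h1 : iotaHom (B x y) = ∑ i, ∑ j, 2 * (X x i * X y j * M i j) := by
    rw [hBxy, map_sum]
    refine Finset.sum_congr rfl fun i _ => ?_
    rw [map_sum]
    refine Finset.sum_congr rfl fun j _ => ?_
    change 2 * bitLift _ = _
    rw [bitLift_mul, bitLift_mul]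
  let p : ι → ι → ZMod 4 := fun i j => X x i * X y j * M i j +
    2 * (X x i * X y i * (X x j + X y j) * M i j)
  have h2 : ∑ i, ∑ j, X (x + y) i * X (x + y) j * M i j =
      ∑ i, ∑ j, X x i * X x j * M i j + ∑ i, ∑ j, X y i * X y j * M i j +
      (∑ i, ∑ j, p i j + ∑ i, ∑ j, p j i) := by
    simp only [← Finset.sum_add_distrib]
    refine Finset.sum_congr rfl fun i _ => Finset.sum_congr rfl fun j _ => ?_
    simp only [p, hX, hM j i]
    linear_combination (X x i * X y i * X x j * X y j * M i j) * four_eq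
  have h3 : ∑ i, ∑ j, p j i = ∑ i, ∑ j, p i j := Finset.sum_comm
  have h4 : ∑ i, ∑ j, p i j + ∑ i, ∑ j, p i j = iotaHom (B x y) := by
    rw [h1]
    simp only [← Finset.sum_add_distrib]
    refine Finset.sum_congr rfl fun i _ => Finset.sum_congr rfl fun j _ => ?_
    simp only [p]
    linear_combination (X x i * X y i * (X x j + X y j) * M i j) * four_eq
  rw [← h4]
  simp only [h2, h3]

/-- the character `a ↦ I ^ a` -/
noncomputable def chi : AddChar (ZMod 4) GaussianInt :=
  AddChar.zmodChar 4 (ζ := (⟨0, 1⟩ : GaussianInt)) (by decide)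

lemma chi_iota_one : chi (iotaHom 1) = -1 := by
  have : iotaHom 1 = 2 := by decide
  rw [this]; decide

lemma exists_kerdock_aux (k : ℕ) (F : Type) [Field F] [Fintype F] [Algebra (ZMod 2) F]
    (hfr : Module.finrank (ZMod 2) F = k) (hcard : Fintype.card F = 2 ^ k) :
    ∃ (t : F → Fin k → ZMod 4),
      (∀ x y, (∀ j, 2 * t x j = 2 * t y j) → x = y) ∧
      (∀ b : Fin k → ZMod 4, (∃ j, 2 * b j ≠ 0) →
        (∑ x, chi (∑ j, b j * t x j)) * (∑ x, chi (- ∑ j, b j * t x j)) = 2 ^ k) := by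
  classical
  have : CharP F 2 := charP_of_injective_algebraMap (algebraMap (ZMod 2) F).injective 2
  let e : Module.Basis (Fin k) (ZMod 2) F := Module.finBasisOfFinrankEq _ _ hfr
  obtain ⟨Q, hQ⟩ := exists_quad e (Algebra.traceForm (ZMod 2) F)
    (fun x y => by simp [Algebra.traceForm_apply, mul_comm])
  simp only [Algebra.traceForm_apply] at hQ
  have hQ0 : Q 0 = 0 := by
    have := hQ 0 0
    simp only [add_zero, mul_zero, map_zero] at this
    simpa using this
  have hQ2 : ∀ z, 2 * Q z = iotaHom (Algebra.trace (ZMod 2) F (z * z)) := fun z => by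
    have := hQ z z
    rw [CharTwo.add_self_eq_zero, hQ0] at this
    rw [← iota_neg]
    linear_combination -this
  have hsq : ∀ c : Fin k → ZMod 2, (∑ j, c j • e j) * (∑ j, c j • e j) = ∑ j, c j • (e j * e j) := by
    intro c
    rw [← pow_two, sum_pow_char 2]
    refine Finset.sum_congr rfl fun j _ => ?_
    rw [smul_pow, ZMod.pow_card, pow_two]
  have hnd : ∀ a : F, a ≠ 0 → ∃ b, Algebra.trace (ZMod 2) F (a * b) ≠ 0 := by
    intro a ha
    have htr := (traceForm_nondegenerate (ZMod 2) F).1 a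
    simp_rw [Algebra.traceForm_apply] at htr
    by_contra! hf
    exact ha (htr hf)
  refine ⟨fun x j => Q (e j * x), fun x y h => ?_, fun b hb => ?_⟩
  · by_contra hxy
    have hd : (x - y) * (x - y) ≠ 0 := mul_self_ne_zero.mpr (sub_ne_zero.mpr hxy)
    obtain ⟨w, hw⟩ := hnd _ hd
    obtain ⟨z, rfl⟩ := FiniteField.isSquare_of_char_two (ringChar.eq F 2) w
    apply hw
    rw [← e.sum_repr z, hsq, Finset.mul_sum, map_sum]
    refine Finset.sum_eq_zero fun j _ => ?_
    have hj := h j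
    rw [hQ2, hQ2] at hj
    have hj := iota_inj _ _ hj
    rw [mul_smul_comm, map_smul]
    have : (x - y) * (x - y) * (e j * e j) = e j * x * (e j * x) - e j * y * (e j * y) := by
      have h2 : (2 : F) = 0 := CharTwo.two_eq_zero
      linear_combination (y * y * e j * e j - x * y * e j * e j) * h2
    rw [this, map_sub, hj, sub_self, smul_zero]
  · let c : Fin k → ZMod 2 := fun j => ((b j).val : ZMod 2)
    let β : F := ∑ j, c j • (e j * e j)
    have hβ : β ≠ 0 := by
      intro h0
      simp only [β] at h0
      rw [← hsq, mul_self_eq_zero] at h0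
      obtain ⟨j, hj⟩ := hb
      apply hj
      apply two_mul_val
      exact (Fintype.linearIndependent_iff.mp e.linearIndependent) c h0 j
    let f : F → ZMod 4 := fun x => ∑ j, b j * Q (e j * x)
    have hf : ∀ x y, f (x + y) = f x + f y + iotaHom (Algebra.trace (ZMod 2) F (β * x * y)) := by
      intro x y
      have : β * x * y = ∑ j, c j • (e j * x * (e j * y)) := by
        simp only [β, Finset.sum_mul]
        refine Finset.sum_congr rfl fun j _ => ?_
        rw [smul_mul_assoc, smul_mul_assoc]; congr 1; ring
      rw [this, map_sum, map_sum]
      simp only [f, ← Finset.sum_add_distrib]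
      refine Finset.sum_congr rfl fun j _ => ?_
      rw [mul_add, hQ, map_smul, smul_eq_mul, ← iota_smul]
      ring
    have hf0 : f 0 = 0 := by simp [f, hQ0]
    change (∑ x, chi (f x)) * (∑ x, chi (- f x)) = 2 ^ k
    have inner : ∀ x, ∑ y, chi (iotaHom (Algebra.trace (ZMod 2) F (β * x * y))) =
        if x = 0 then 2 ^ k else 0 := by
      intro x
      split_ifs with hx
      · simp [hx, hcard]
      · obtain ⟨y0, hy0⟩ := hnd (β * x) (mul_ne_zero hβ hx)
        have h1 : ∀ a : ZMod 2, a ≠ 0 → a = 1 := by decide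
        have hy0 := h1 _ hy0
        have := Fintype.sum_equiv (Equiv.addRight y0)
          (fun y => chi (iotaHom (Algebra.trace (ZMod 2) F (β * x * (y + y0)))))
          (fun y => chi (iotaHom (Algebra.trace (ZMod 2) F (β * x * y)))) (fun y => rfl)
        simp only [mul_add, map_add, AddChar.map_add_eq_mul, hy0, chi_iota_one, ← Finset.sum_mul] at this
        have h2 : (2 : GaussianInt) * ∑ y, chi (iotaHom (Algebra.trace (ZMod 2) F (β * x * y))) = 0 := by
          linear_combination -this
        exact (mul_eq_zero.mp h2).resolve_left (by decide)
    calc (∑ x, chi (f x)) * (∑ x, chi (- f x))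
        = ∑ y, ∑ x, chi (f x) * chi (- f y) := by
          rw [Finset.mul_sum]; simp only [Finset.sum_mul]
      _ = ∑ y, ∑ x, chi (f (x + y)) * chi (- f y) := by
          refine Finset.sum_congr rfl fun y _ => ?_
          exact (Fintype.sum_equiv (Equiv.addRight y) _ _ (fun x => rfl)).symm
      _ = ∑ y, ∑ x, chi (f x) * chi (iotaHom (Algebra.trace (ZMod 2) F (β * x * y))) := by
          refine Finset.sum_congr rfl fun y _ => Finset.sum_congr rfl fun x _ => ?_
          rw [← AddChar.map_add_eq_mul, ← AddChar.map_add_eq_mul, hf]; congr 1; ring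
      _ = 2 ^ k := by
          rw [Finset.sum_comm]
          simp only [← Finset.mul_sum, inner]
          simp [hf0]

lemma exists_kerdock (k : ℕ) (hk : k ≠ 0) :
    ∃ (F : Type) (_ : Fintype F) (t : F → Fin k → ZMod 4),
      (∀ x y, (∀ j, 2 * t x j = 2 * t y j) → x = y) ∧
      (∀ b : Fin k → ZMod 4, (∃ j, 2 * b j ≠ 0) →
        (∑ x, chi (∑ j, b j * t x j)) * (∑ x, chi (- ∑ j, b j * t x j)) = 2 ^ k) := by
  have : Fintype (GaloisField 2 k) := Fintype.ofFinite _
  have hfr : Module.finrank (ZMod 2) (GaloisField 2 k) = k := GaloisField.finrank 2 hk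
  have hcard : Fintype.card (GaloisField 2 k) = 2 ^ k := by
    rw [← Nat.card_eq_fintype_card]; exact GaloisField.card 2 k hk
  exact ⟨_, _, exists_kerdock_aux k _ hfr hcard⟩

lemma sq_add_sq_eq (m : ℕ) : ∀ a b : ℤ, a ^ 2 + b ^ 2 = 2 ^ (2 * m + 1) →
    a = 2 ^ m ∨ a = - 2 ^ m := by
  induction m with
  | zero =>
    intro a b h
    norm_num at h
    have h1 : a ≤ 1 := by nlinarith [sq_nonneg b]
    have h2 : -1 ≤ a := by nlinarith [sq_nonneg b]
    have h3 : b ≤ 1 := by nlinarith [sq_nonneg a]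
    have h4 : -1 ≤ b := by nlinarith [sq_nonneg a]
    interval_cases a <;> interval_cases b <;> simp_all
  | succ m ih =>
    intro a b h
    have h4 : a ^ 2 + b ^ 2 = 4 * 2 ^ (2 * m + 1) := by rw [h]; ring
    rcases Int.even_or_odd' a with ⟨c, rfl | rfl⟩ <;> rcases Int.even_or_odd' b with ⟨d, rfl | rfl⟩
    · have := ih c d (by nlinarith)
      rcases this with h | h
      · left; rw [h]; ring
      · right; rw [h]; ring
    all_goals
      exfalso
      generalize (2 : ℤ) ^ (2 * m + 1) = w at h4
      ring_nf at h4
      omega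

lemma chi_neg : ∀ a, chi (-a) = star (chi a) := by decide

lemma lee_eq : ∀ a, (leeWt a : ℤ) = 1 - (chi a).re := by decide

lemma leeWt_neg : ∀ a, leeWt (-a) = leeWt a := by decide

lemma sum_chi_one : ∀ v : ZMod 4, ∑ b, chi (v * b) = if v = 0 then 4 else 0 := by decide

lemma sum_chi_two : ∀ v : ZMod 4, ∑ b ∈ Finset.univ.filter (fun b : ZMod 4 => 2 * b = 0), chi (v * b) =
    if 2 * v = 0 then 2 else 0 := by decide

lemma chi_sum {ι : Type*} (s : Finset ι) (f : ι → ZMod 4) : chi (∑ i ∈ s, f i) = ∏ i ∈ s, chi (f i) := by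
  classical
  induction s using Finset.induction_on with
  | empty => simp
  | insert a s ha ih =>
    rw [Finset.sum_insert ha, Finset.prod_insert ha, AddChar.map_add_eq_mul, ih]

/-- Fourier transform of the set of vectors which are nonzero mod 2 -/
def eInt {k : ℕ} (v : Fin k → ZMod 4) : ℤ :=
  (if ∀ j, v j = 0 then 4 ^ k else 0) - (if ∀ j, 2 * v j = 0 then 2 ^ k else 0)

lemma sum_good {k : ℕ} (v : Fin k → ZMod 4) :
    ∑ b ∈ Finset.univ.filter (fun b : Fin k → ZMod 4 => ∃ j, 2 * b j ≠ 0), chi (∑ j, b j * v j) =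
      (eInt v : GaussianInt) := by
  classical
  have h1 : ∑ b : Fin k → ZMod 4, chi (∑ j, b j * v j) = if ∀ j, v j = 0 then 4 ^ k else 0 := by
    simp only [chi_sum]
    have := (Finset.prod_univ_sum (fun _ : Fin k => (Finset.univ : Finset (ZMod 4)))
      (fun j b => chi (b * v j))).symm
    rw [Fintype.piFinset_univ] at this
    rw [this]
    simp only [mul_comm _ (v _), sum_chi_one, Fintype.prod_ite_zero]
    simp
  have h2 : ∑ b ∈ Finset.univ.filter (fun b : Fin k → ZMod 4 => ¬ ∃ j, 2 * b j ≠ 0),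
      chi (∑ j, b j * v j) = if ∀ j, 2 * v j = 0 then 2 ^ k else 0 := by
    simp only [chi_sum]
    have := (Finset.prod_univ_sum
      (fun _ : Fin k => Finset.univ.filter (fun b : ZMod 4 => 2 * b = 0))
      (fun j b => chi (b * v j))).symm
    have hs : Finset.univ.filter (fun b : Fin k → ZMod 4 => ¬ ∃ j, 2 * b j ≠ 0) =
      Fintype.piFinset (fun _ : Fin k => Finset.univ.filter (fun b : ZMod 4 => 2 * b = 0)) := by
      ext b; simp
    rw [hs, this]
    simp only [mul_comm _ (v _), sum_chi_two, Fintype.prod_ite_zero]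
    simp
  have h3 := Finset.sum_filter_add_sum_filter_not Finset.univ
    (fun b : Fin k → ZMod 4 => ∃ j, 2 * b j ≠ 0) (fun b => chi (∑ j, b j * v j))
  rw [h1, h2] at h3
  rw [eInt, ← sub_eq_iff_eq_add.mpr h3.symm]
  push_cast
  rfl

/-- pairing -/
def pairing {k : ℕ} (p q : ZMod 4 × (Fin k → ZMod 4)) : ZMod 4 := p.1 * q.1 + ∑ j, p.2 j * q.2 j

lemma pairing_add {k : ℕ} (p q r : ZMod 4 × (Fin k → ZMod 4)) :
    pairing p (q + r) = pairing p q + pairing p r := by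
  simp only [pairing, Prod.fst_add, Prod.snd_add, Pi.add_apply, mul_add, Finset.sum_add_distrib]
  ring

lemma pairing_smul {k : ℕ} (c : ZMod 4) (p q : ZMod 4 × (Fin k → ZMod 4)) :
    pairing p (c • q) = c * pairing p q := by
  simp only [pairing, Prod.smul_fst, Prod.smul_snd, Pi.smul_apply, smul_eq_mul, mul_add,
    Finset.mul_sum]
  congr 1
  · ring
  · exact Finset.sum_congr rfl fun j _ => by ring

lemma pairing_neg {k : ℕ} (p q : ZMod 4 × (Fin k → ZMod 4)) :
    pairing p (-q) = - pairing p q := by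
  simp [pairing]; ring

lemma neg_pairing {k : ℕ} (p q : ZMod 4 × (Fin k → ZMod 4)) :
    pairing (-p) q = - pairing p q := by
  simp [pairing]; ring

lemma exists_half {V : Type*} [AddGroup V] [Fintype V] (G : Finset V)
    (hneg : ∀ p ∈ G, -p ∈ G) (hne : ∀ p ∈ G, -p ≠ p) :
    ∃ H : Finset V, ∀ g : V → ℕ, (∀ p, g (-p) = g p) → ∑ p ∈ G, g p = 2 * ∑ p ∈ H, g p := by
  classical
  let e := Fintype.equivFin V
  refine ⟨G.filter (fun p => e p < e (-p)), fun g hg => ?_⟩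
  rw [← Finset.sum_filter_add_sum_filter_not G (fun p => e p < e (-p)) g, two_mul]
  congr 1
  refine Finset.sum_nbij' (fun p => -p) (fun p => -p) ?_ ?_ ?_ ?_ ?_
  · intro p hp
    simp only [Finset.mem_filter, not_lt, neg_neg] at hp ⊢
    refine ⟨hneg p hp.1, lt_of_le_of_ne hp.2 fun h => hne p hp.1 (e.injective h)⟩
  · intro p hp
    simp only [Finset.mem_filter, not_lt, neg_neg] at hp ⊢
    exact ⟨hneg p hp.1, hp.2.le⟩
  · simp
  · simp
  · intro p _; exact (hg p).symm

/-- Fourier transform of the good set in the product -/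
def aInt {k : ℕ} (q : ZMod 4 × (Fin k → ZMod 4)) : ℤ := if q.1 = 0 then 4 * eInt q.2 else 0

/-- the vectors that are nonzero mod 2 in the second component -/
def goodSet (k : ℕ) : Finset (ZMod 4 × (Fin k → ZMod 4)) :=
  Finset.univ.filter (fun p => ∃ j, 2 * p.2 j ≠ 0)

lemma sum_goodSet {k : ℕ} (q : ZMod 4 × (Fin k → ZMod 4)) :
    ∑ p ∈ goodSet k, chi (pairing p q) = (aInt q : GaussianInt) := by
  have hprod : goodSet k = (Finset.univ : Finset (ZMod 4)) ×ˢ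
      Finset.univ.filter (fun b : Fin k → ZMod 4 => ∃ j, 2 * b j ≠ 0) := by
    ext p; simp [goodSet]
  rw [hprod, Finset.sum_product]
  simp only [pairing, AddChar.map_add_eq_mul, ← Finset.mul_sum, sum_good, ← Finset.sum_mul]
  simp only [mul_comm _ q.1, sum_chi_one, aInt]
  split_ifs <;> simp

lemma exists_weights (m : ℕ) : ∃ H : Finset (ZMod 4 × (Fin (2 * m + 1) → ZMod 4)),
    (H.card = 4 ^ (2 * m + 1) - 2 ^ (2 * m + 1)) ∧
    (∀ q, q ≠ 0 → (4 : ℤ) ^ (2 * m + 1) - 2 ^ (2 * m + 1) ≤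
      ∑ p ∈ H, (leeWt (pairing p q) : ℤ) + 2 ^ m * (if 2 * q.1 = 0 then 0 else 1)) ∧
    (∑ p ∈ H, (leeWt (pairing p (2, 0)) : ℤ) = 4 ^ (2 * m + 1) - 2 ^ (2 * m + 1)) := by
  classical
  set k := 2 * m + 1 with hk
  obtain ⟨F, _, t, ht, hS⟩ := exists_kerdock k (by omega)
  let τ : F → ZMod 4 × (Fin k → ZMod 4) := fun x => (1, t x)
  let S : ZMod 4 × (Fin k → ZMod 4) → GaussianInt := fun p => ∑ x, chi (pairing p (τ x))
  have hSneg : ∀ p, S (-p) = star (S p) := by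
    intro p
    simp only [S, star_sum, neg_pairing, chi_neg]
  have hSre : ∀ p ∈ goodSet k, (S p).re = 2 ^ m ∨ (S p).re = - 2 ^ m := by
    intro p hp
    have hp : ∃ j, 2 * p.2 j ≠ 0 := by simpa [goodSet] using hp
    apply sq_add_sq_eq m _ (S p).im
    have h1 : S p = chi p.1 * ∑ x, chi (∑ j, p.2 j * t x j) := by
      simp only [S, pairing, τ, AddChar.map_add_eq_mul, mul_one, Finset.mul_sum]
    have h2 : S (-p) = chi (-p.1) * ∑ x, chi (-∑ j, p.2 j * t x j) := by
      simp only [S, neg_pairing]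
      simp only [pairing, τ, neg_add, AddChar.map_add_eq_mul, mul_one, Finset.mul_sum]
    have h3 : S p * star (S p) = 2 ^ k := by
      rw [← hSneg, h1, h2, ← hS p.2 hp]
      have : chi p.1 * chi (-p.1) = 1 := by
        rw [← AddChar.map_add_eq_mul, add_neg_cancel, AddChar.map_zero_eq_one]
      linear_combination ((∑ x, chi (∑ j, p.2 j * t x j)) * ∑ x, chi (-∑ j, p.2 j * t x j)) * this
    have h4 := congrArg Zsqrtd.re h3
    have h5 : ((2 : GaussianInt) ^ k).re = 2 ^ k := by
      have : (2 : GaussianInt) ^ k = ((2 ^ k : ℤ) : GaussianInt) := by push_cast; rfl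
      rw [this, Zsqrtd.re_intCast]
    rw [h5] at h4
    simp only [Zsqrtd.re_mul, Zsqrtd.re_star, Zsqrtd.im_star] at h4
    rw [← hk, ← h4]; ring
  let G := (goodSet k).filter (fun p => (S p).re = - 2 ^ m)
  let f : ZMod 4 × (Fin k → ZMod 4) → ℤ := fun q => (∑ p ∈ G, chi (pairing p q)).re
  have hf : ∀ q, 2 ^ (m + 2) * f q =
      2 ^ (m + 1) * aInt q - ∑ x, aInt (q + τ x) - ∑ x, aInt (q - τ x) := by
    intro q
    have h1 : (2 : GaussianInt) ^ (m + 2) * ∑ p ∈ G, chi (pairing p q) =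
        ∑ p ∈ goodSet k, (2 ^ (m + 1) - S p - S (-p)) * chi (pairing p q) := by
      simp only [G, Finset.mul_sum, Finset.sum_filter]
      refine Finset.sum_congr rfl fun p hp => ?_
      have h2 : S p + S (-p) = ((2 * (S p).re : ℤ) : GaussianInt) := by
        rw [hSneg]
        ext
        · rw [Zsqrtd.re_intCast]; simp; ring
        · rw [Zsqrtd.im_intCast]; simp
      have hpos : (0 : ℤ) < 2 ^ m := by positivity
      rw [sub_sub, h2]
      rcases hSre p hp with h | h
      · rw [if_neg (by rw [h]; intro h; linarith), h]
        push_cast; ring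
      · rw [if_pos h, h]
        push_cast; ring
    have h2 : ∑ p ∈ goodSet k, S p * chi (pairing p q) = ((∑ x, aInt (q + τ x) : ℤ) : GaussianInt) := by
      push_cast
      simp only [← sum_goodSet, S, Finset.sum_mul]
      rw [Finset.sum_comm]
      refine Finset.sum_congr rfl fun x _ => Finset.sum_congr rfl fun p _ => ?_
      rw [← AddChar.map_add_eq_mul, pairing_add, add_comm]
    have h3 : ∑ p ∈ goodSet k, S (-p) * chi (pairing p q) = ((∑ x, aInt (q - τ x) : ℤ) : GaussianInt) := by
      push_cast
      simp only [← sum_goodSet, S, Finset.sum_mul]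
      rw [Finset.sum_comm]
      refine Finset.sum_congr rfl fun x _ => Finset.sum_congr rfl fun p _ => ?_
      rw [← AddChar.map_add_eq_mul, sub_eq_add_neg, pairing_add, neg_pairing, pairing_neg, add_comm]
    have h4 : (((2 : ℤ) ^ (m + 2) : ℤ) : GaussianInt) * ∑ p ∈ G, chi (pairing p q) =
        ((2 ^ (m + 1) * aInt q - ∑ x, aInt (q + τ x) - ∑ x, aInt (q - τ x) : ℤ) : GaussianInt) := by
      rw [Int.cast_sub, Int.cast_sub, ← h2, ← h3, Int.cast_mul, ← sum_goodSet]
      push_cast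
      rw [h1, Finset.mul_sum, ← Finset.sum_sub_distrib, ← Finset.sum_sub_distrib]
      exact Finset.sum_congr rfl fun p _ => by ring
    have h5 := congrArg Zsqrtd.re h4
    rw [Zsqrtd.re_intCast] at h5
    rw [← h5, Zsqrtd.re_smul]
  have hlee : ∀ q, ∑ p ∈ G, (leeWt (pairing p q) : ℤ) = G.card - f q := by
    intro q
    have : (∑ p ∈ G, chi (pairing p q)).re = ∑ p ∈ G, (chi (pairing p q)).re := by
      induction G using Finset.induction_on with
      | empty => simp
      | insert a s ha ih => rw [Finset.sum_insert ha, Finset.sum_insert ha, Zsqrtd.re_add, ih]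
    simp only [f, this, lee_eq, Finset.sum_sub_distrib]
    simp
  have hpos : (0 : ℤ) < 2 ^ (m + 2) := by positivity
  -- the values of `f`
  have hne1 : ∀ u : ZMod 4, 2 * u = 0 → u + 1 ≠ 0 ∧ u - 1 ≠ 0 := by decide
  have hfeven : ∀ q, 2 * q.1 = 0 → 2 * f q = aInt q := by
    intro q hq
    have h1 := hf q
    have h2 : ∀ x, aInt (q + τ x) = 0 := fun x => if_neg (hne1 _ hq).1
    have h3 : ∀ x, aInt (q - τ x) = 0 := fun x => if_neg (hne1 _ hq).2
    simp only [h2, h3, Finset.sum_const_zero, sub_zero] at h1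
    have : (2 : ℤ) ^ (m + 1) * (2 * f q) = 2 ^ (m + 1) * aInt q := by
      rw [← h1]; ring
    exact mul_left_cancel₀ (by positivity) this
  have hf0 : f 0 = 2 * (4 ^ k - 2 ^ k) := by
    have := hfeven 0 (by simp)
    simp only [aInt, eInt, Prod.fst_zero, Prod.snd_zero, Pi.zero_apply, mul_zero, implies_true,
      if_true] at this
    linarith
  have hcard : (G.card : ℤ) = 2 * (4 ^ k - 2 ^ k) := by
    have := hlee 0
    have h0 : ∀ p : ZMod 4 × (Fin k → ZMod 4), leeWt (pairing p 0) = 0 := by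
      intro p; simp [pairing, leeWt]
    simp only [h0, Nat.cast_zero, Finset.sum_const_zero] at this
    linarith
  -- bound of the sum over a transversal
  have hbound : ∀ (g : F → Fin k → ZMod 4),
      (∀ x y, (∀ j, 2 * g x j = 0) → (∀ j, 2 * g y j = 0) → x = y) →
      - 2 ^ k ≤ ∑ x, eInt (g x) := by
    intro g hg
    have h1 : ∀ x, -(if ∀ j, 2 * g x j = 0 then (2 : ℤ) ^ k else 0) ≤ eInt (g x) := by
      intro x
      have : (0 : ℤ) ≤ if ∀ j, g x j = 0 then 4 ^ k else 0 := by positivity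
      simp only [eInt]; linarith
    refine le_trans ?_ (Finset.sum_le_sum fun x _ => h1 x)
    rw [Finset.sum_neg_distrib, neg_le_neg_iff, ← Finset.sum_filter, Finset.sum_const, nsmul_eq_mul]
    have : (Finset.univ.filter (fun x => ∀ j, 2 * g x j = 0)).card ≤ 1 := by
      rw [Finset.card_le_one]
      intro a ha b hb
      simp only [Finset.mem_filter, Finset.mem_univ, true_and] at ha hb
      exact hg a b ha hb
    have h2 : ((Finset.univ.filter (fun x => ∀ j, 2 * g x j = 0)).card : ℤ) ≤ 1 := by exact_mod_cast this
    have h3 : (0 : ℤ) ≤ 2 ^ k := by positivity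
    nlinarith
  have hpk : (2 : ℤ) ^ k = 2 ^ m * 2 ^ (m + 1) := by rw [hk]; ring
  have hfodd : ∀ q, 2 * q.1 ≠ 0 → f q ≤ 2 ^ (m + 1) := by
    intro q hq
    have h1 := hf q
    have ha : aInt q = 0 := if_neg (fun h => hq (by rw [h]; rfl))
    have hcase : ∀ u : ZMod 4, 2 * u ≠ 0 → (u + 1 = 0 ∧ u - 1 ≠ 0) ∨ (u + 1 ≠ 0 ∧ u - 1 = 0) := by
      decide
    have key : 2 ^ (m + 2) * f q ≤ 4 * 2 ^ k := by
      rcases hcase q.1 hq with ⟨hp, hm⟩ | ⟨hp, hm⟩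
      · have h2 : ∀ x, aInt (q + τ x) = 4 * eInt (q.2 + t x) := fun x => if_pos hp
        have h3 : ∀ x, aInt (q - τ x) = 0 := fun x => if_neg hm
        simp only [ha, h2, h3, ← Finset.mul_sum, Finset.sum_const_zero] at h1
        have := hbound (fun x => q.2 + t x) (fun x y hx hy => ht x y fun j => by
          have h5 := hx j
          have h6 := hy j
          simp only [Pi.add_apply] at h5 h6
          linear_combination h5 - h6)
        linarith
      · have h2 : ∀ x, aInt (q + τ x) = 0 := fun x => if_neg hp
        have h3 : ∀ x, aInt (q - τ x) = 4 * eInt (q.2 - t x) := fun x => if_pos hm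
        simp only [ha, h2, h3, ← Finset.mul_sum, Finset.sum_const_zero] at h1
        have := hbound (fun x => q.2 - t x) (fun x y hx hy => ht x y fun j => by
          have h5 := hx j
          have h6 := hy j
          simp only [Pi.sub_apply] at h5 h6
          linear_combination h6 - h5)
        linarith
    have : (2 : ℤ) ^ (m + 2) * f q ≤ 2 ^ (m + 2) * 2 ^ (m + 1) := by
      refine key.trans (le_of_eq ?_)
      rw [hpk]; ring
    exact le_of_mul_le_mul_left this hpos
  have hmemG : ∀ p, p ∈ G ↔ (∃ j, 2 * p.2 j ≠ 0) ∧ (S p).re = - 2 ^ m := by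
    intro p; simp [G, goodSet]
  obtain ⟨H, hH⟩ := exists_half G
    (by
      intro p hp
      rw [hmemG] at hp ⊢
      rw [hSneg, Zsqrtd.re_star]
      simpa using hp)
    (by
      intro p hp h
      obtain ⟨⟨j, hj⟩, -⟩ := (hmemG p).mp hp
      apply hj
      have := congrFun (congrArg Prod.snd h) j
      simp only [Prod.snd_neg, Pi.neg_apply] at this
      linear_combination -this)
  have hHc : (H.card : ℤ) = 4 ^ k - 2 ^ k := by
    have := hH (fun _ => 1) (fun _ => rfl)
    simp only [Finset.sum_const, smul_eq_mul, mul_one] at this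
    have : (G.card : ℤ) = 2 * H.card := by exact_mod_cast this
    linarith
  have hHlee : ∀ q, 2 * ∑ p ∈ H, (leeWt (pairing p q) : ℤ) = 2 * (4 ^ k - 2 ^ k) - f q := by
    intro q
    have := hH (fun p => leeWt (pairing p q)) (fun p => by simp only [neg_pairing, leeWt_neg])
    have : ∑ p ∈ G, (leeWt (pairing p q) : ℤ) = 2 * ∑ p ∈ H, (leeWt (pairing p q) : ℤ) := by
      exact_mod_cast this
    rw [← this, hlee, hcard]
  refine ⟨H, ?_, ?_, ?_⟩
  · have h24 : 2 ^ k ≤ 4 ^ k := Nat.pow_le_pow_left (by norm_num) k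
    zify [h24]
    exact hHc
  · intro q hq
    have h1 := hHlee q
    split_ifs with h
    · have h2 := hfeven q h
      have : aInt q ≤ 0 := by
        simp only [aInt]
        split_ifs with h0
        · have : ¬ ∀ j, q.2 j = 0 := fun h3 => hq (Prod.ext h0 (funext h3))
          simp only [eInt, if_neg this]
          split_ifs
          · have : (0 : ℤ) < 2 ^ k := by positivity
            linarith
          · simp
        · exact le_rfl
      linarith
    · have h2 := hfodd q h
      rw [pow_succ] at h2
      linarith
  · have h1 := hHlee (2, 0)
    have h2 := hfeven (2, 0) (show (2 : ZMod 4) * 2 = 0 by decide)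
    have h3 : aInt ((2, 0) : ZMod 4 × (Fin k → ZMod 4)) = 0 := if_neg (show ¬ (2 : ZMod 4) = 0 by decide)
    linarith

/-- Extended dualized Kerdock codes: for every odd `k ≥ 3` there exists a `ZMod 4`-linear
code of length `2^{2k} − 2^k + 2^{(k−3)/2}` with `4^{k+1}` codewords and minimum Lee
weight exactly `2^{2k} − 2^k`. -/
theorem extended_dualized_kerdock_exists (k : ℕ) (hk : 3 ≤ k) (hodd : Odd k) :
    ∃ C : Submodule (ZMod 4) (Fin (2 ^ (2 * k) - 2 ^ k + 2 ^ ((k - 3) / 2)) → ZMod 4),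
      Nat.card C = 4 ^ (k + 1) ∧
      IsLeast {w : ℕ | ∃ c ∈ C, c ≠ 0 ∧ leeWeight c = w} (2 ^ (2 * k) - 2 ^ k) := by
  classical
  obtain ⟨m, rfl⟩ := hodd
  obtain ⟨r, rfl⟩ : ∃ r, m = r + 1 := ⟨m - 1, by omega⟩
  have hr : (2 * (r + 1) + 1 - 3) / 2 = r := by omega
  obtain ⟨H, hHc, hHw, hH2⟩ := exists_weights (r + 1)
  rw [hr]
  generalize 2 * (r + 1) + 1 = k at *
  have h24 : 2 ^ k ≤ 4 ^ k := Nat.pow_le_pow_left (by norm_num) k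
  have hlt : 2 ^ k < 4 ^ k := Nat.pow_lt_pow_left (by norm_num) (by omega)
  have h4 : 2 ^ (2 * k) = 4 ^ k := by rw [pow_mul]; norm_num
  rw [h4]
  have hcard : Fintype.card (H ⊕ Fin (2 ^ r)) = 4 ^ k - 2 ^ k + 2 ^ r := by
    simp [hHc]
  let σ : Fin (4 ^ k - 2 ^ k + 2 ^ r) ≃ H ⊕ Fin (2 ^ r) := (Fintype.equivFinOfCardEq hcard).symm
  let L : (ZMod 4 × (Fin k → ZMod 4)) →ₗ[ZMod 4] (Fin (4 ^ k - 2 ^ k + 2 ^ r) → ZMod 4) :=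
    { toFun := fun q i => Sum.elim (fun p : H => pairing p.1 q) (fun _ => 2 * q.1) (σ i)
      map_add' := by
        intro q q'
        funext i
        simp only [Pi.add_apply]
        rcases σ i with p | j
        · simp [pairing_add]
        · simp [mul_add]
      map_smul' := by
        intro c q
        funext i
        simp only [Pi.smul_apply, RingHom.id_apply]
        rcases σ i with p | j
        · simp [pairing_smul]
        · simp [mul_left_comm] }
  have hW : ∀ q, (leeWeight (L q) : ℤ) =
      ∑ p ∈ H, (leeWt (pairing p q) : ℤ) + 2 ^ (r + 1) * (if 2 * q.1 = 0 then 0 else 1) := by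
    intro q
    have h1 : leeWeight (L q) = ∑ s : H ⊕ Fin (2 ^ r),
        leeWt (Sum.elim (fun p : H => pairing p.1 q) (fun _ => 2 * q.1) s) :=
      Fintype.sum_equiv σ _ _ (fun i => rfl)
    have h2 : ∀ u : ZMod 4, (leeWt (2 * u) : ℤ) = 2 * (if 2 * u = 0 then 0 else 1) := by decide
    rw [h1, Fintype.sum_sum_type]
    simp only [Sum.elim_inl, Sum.elim_inr, Finset.sum_const, Finset.card_univ, Fintype.card_fin,
      smul_eq_mul]
    rw [Finset.sum_coe_sort H (fun p => leeWt (pairing p q))]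
    push_cast
    rw [h2]
    ring
  have hge : ∀ q, q ≠ 0 → 4 ^ k - 2 ^ k ≤ leeWeight (L q) := by
    intro q hq
    have := hHw q hq
    rw [← hW] at this
    zify [h24]
    exact this
  have hz : leeWeight (0 : Fin (4 ^ k - 2 ^ k + 2 ^ r) → ZMod 4) = 0 := by simp [leeWeight, leeWt]
  have hL0 : ∀ q, q ≠ 0 → L q ≠ 0 := by
    intro q hq h
    have := hge q hq
    rw [h, hz] at this
    omega
  have hinj : Function.Injective L := by
    rw [injective_iff_map_eq_zero]
    intro q hq
    by_contra h
    exact hL0 q h hq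
  refine ⟨LinearMap.range L, ?_, ⟨L (2, 0), ⟨_, rfl⟩, ?_, ?_⟩, ?_⟩
  · rw [← Nat.card_congr (LinearEquiv.ofInjective L hinj).toEquiv]
    simp [Nat.card_eq_fintype_card, pow_succ, mul_comm]
  · refine hL0 _ fun h => ?_
    have := congrArg Prod.fst h
    revert this
    simp only [Prod.fst_zero]
    decide
  · have h1 := hW (2, 0)
    rw [hH2, if_pos (show (2 : ZMod 4) * 2 = 0 by decide)] at h1
    zify [h24]
    linarith
  · rintro w ⟨c, ⟨q, rfl⟩, hc, rfl⟩
    exact hge q (fun h => hc (by rw [h, map_zero]))
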